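/- Let (S, μ) be a finite measure space and r > 0. Then the Orlicz space Φ_r(S) associated with the Orlicz function Φ_r(t) = t([1 + log(1+t)]^r − 1), equipped with the Luxemburg norm, coincides with the Lorentz–Zygmund space L log^r L(S), with equivalent norms: there exist constants c, C > 0 (depending on r and μ(S)) such that c‖f‖_{Φ_r(S)} ≤ ‖f‖_{L log^r L(S)} ≤ C‖f‖_{Φ_r(S)} for all measurable f. -/

import Mathlib

open MeasureTheory Set
open scoped ENNReal Real

/-- The nonincreasing rearrangement of `f` with respect to `μ`. -/
noncomputable def rearrangement {α : Type*} [MeasurableSpace α] (μ : Measure α)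
    (f : α → ℂ) (t : ℝ) : ℝ≥0∞ :=
  sInf {l : ℝ≥0∞ | μ {x | l < (‖f x‖₊ : ℝ≥0∞)} ≤ ENNReal.ofReal t}

/-- The Orlicz function `Φ_r(t) = t([1 + log(1+t)]^r - 1)`. -/
noncomputable def PhiR (r t : ℝ) : ℝ := t * ((1 + Real.log (1 + t)) ^ r - 1)

/-- The Luxemburg norm of `f` for the Orlicz function `Φ_r`. -/
noncomputable def luxemburgNorm {α : Type*} [MeasurableSpace α] (μ : Measure α)
    (r : ℝ) (f : α → ℂ) : ℝ≥0∞ :=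
  sInf {l : ℝ≥0∞ | ∃ c : ℝ, 0 < c ∧ l = ENNReal.ofReal c ∧
    (∫⁻ x, ENNReal.ofReal (PhiR r (‖f x‖ / c)) ∂μ) ≤ 1}

/-- The Lorentz–Zygmund norm `‖f‖_{L log^r L} = ∫₀^∞ f^*(t)(1 + |log t|)^r dt`. -/
noncomputable def lorentzZygmundNorm {α : Type*} [MeasurableSpace α] (μ : Measure α)
    (r : ℝ) (f : α → ℂ) : ℝ≥0∞ :=
  ∫⁻ t in Ioi (0 : ℝ),
    rearrangement μ f t * ENNReal.ofReal ((1 + |Real.log t|) ^ r)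

/-- The distribution function characterization of the rearrangement. -/
lemma rearr_le_iff {α : Type*} [MeasurableSpace α] (μ : Measure α) [IsFiniteMeasure μ]
    (f : α → ℂ) (t : ℝ) (s : ℝ≥0∞) :
    rearrangement μ f t ≤ s ↔ μ {x | s < (‖f x‖₊ : ℝ≥0∞)} ≤ ENNReal.ofReal t := by
  constructor
  · intro h
    by_cases hs : s = ⊤
    · subst hs; simp
    obtain ⟨u, hu_anti, hu_gt, hu_lim⟩ := exists_seq_strictAnti_tendsto' (lt_top_iff_ne_top.2 hs)
    have hU : {x | s < (‖f x‖₊ : ℝ≥0∞)} = ⋃ n, {x | u n < (‖f x‖₊ : ℝ≥0∞)} := by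
      ext x
      simp only [mem_ofPred_eq, mem_iUnion]
      constructor
      · intro hx
        exact ((hu_lim.eventually (gt_mem_nhds hx)).exists)
      · rintro ⟨n, hn⟩
        exact (hu_gt n).1.trans hn
    rw [hU, Monotone.measure_iUnion]
    · refine iSup_le fun n => ?_
      have h1 : rearrangement μ f t < u n := h.trans_lt (hu_gt n).1
      obtain ⟨l, hl, hlu⟩ := sInf_lt_iff.1 h1
      refine le_trans (measure_mono ?_) hl
      intro x hx
      exact hlu.trans hx
    · intro m n hmn x hx
      exact lt_of_le_of_lt (hu_anti.antitone hmn) hx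
  · intro h
    exact sInf_le h

lemma rearr_antitone {α : Type*} [MeasurableSpace α] (μ : Measure α)
    (f : α → ℂ) : Antitone (rearrangement μ f) := by
  intro a b hab
  refine sInf_le_sInf ?_
  intro l hl
  exact le_trans hl (ENNReal.ofReal_le_ofReal hab)

lemma rearr_map {α : Type*} [MeasurableSpace α] (μ : Measure α) [IsFiniteMeasure μ]
    (f : α → ℂ) (hf : Measurable f) :
    Measure.map (rearrangement μ f) (volume.restrict (Ioo (0:ℝ) (μ univ).toReal)) =
      Measure.map (fun x => (‖f x‖₊ : ℝ≥0∞)) μ := by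
  have hm := (rearr_antitone μ f).measurable
  have hn : Measurable (fun x => (‖f x‖₊ : ℝ≥0∞)) := by fun_prop
  have hfin : IsFiniteMeasure (volume.restrict (Ioo (0:ℝ) (μ univ).toReal)) :=
    ⟨by simp⟩
  have huniv : Measure.map (rearrangement μ f) (volume.restrict (Ioo (0:ℝ) (μ univ).toReal)) univ =
      Measure.map (fun x => (‖f x‖₊ : ℝ≥0∞)) μ univ := by
    rw [Measure.map_apply hm MeasurableSet.univ, Measure.map_apply hn MeasurableSet.univ]
    simp
  have hIoi : ∀ s : ℝ≥0∞,
      Measure.map (rearrangement μ f) (volume.restrict (Ioo (0:ℝ) (μ univ).toReal)) (Ioi s) =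
      Measure.map (fun x => (‖f x‖₊ : ℝ≥0∞)) μ (Ioi s) := by
    intro s
    rw [Measure.map_apply hm measurableSet_Ioi, Measure.map_apply hn measurableSet_Ioi,
      Measure.restrict_apply (hm measurableSet_Ioi)]
    have hne : μ {x | s < (‖f x‖₊ : ℝ≥0∞)} ≠ ⊤ := measure_ne_top _ _
    have : rearrangement μ f ⁻¹' Ioi s ∩ Ioo 0 (μ univ).toReal =
        Ioo 0 (μ {x | s < (‖f x‖₊ : ℝ≥0∞)}).toReal := by
      ext t
      simp only [mem_inter_iff, mem_preimage, mem_Ioi, mem_Ioo]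
      rw [← not_le, rearr_le_iff, not_le]
      constructor
      · rintro ⟨h1, h2, h3⟩
        exact ⟨h2, (ENNReal.ofReal_lt_iff_lt_toReal h2.le hne).1 h1⟩
      · rintro ⟨h2, h1⟩
        exact ⟨(ENNReal.ofReal_lt_iff_lt_toReal h2.le hne).2 h1, h2, h1.trans_le
          (ENNReal.toReal_mono (measure_ne_top _ _) (measure_mono (subset_univ _)))⟩
    rw [this, Real.volume_Ioo, sub_zero, ENNReal.ofReal_toReal hne]
    rfl
  refine Measure.ext_of_Iic _ _ fun s => ?_
  rw [← compl_Ioi, measure_compl measurableSet_Ioi (measure_ne_top _ _),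
    measure_compl measurableSet_Ioi (measure_ne_top _ _), huniv, hIoi]

lemma rearr_lintegral {α : Type*} [MeasurableSpace α] (μ : Measure α) [IsFiniteMeasure μ]
    (f : α → ℂ) (hf : Measurable f) (φ : ℝ≥0∞ → ℝ≥0∞) (hφ : Measurable φ) :
    ∫⁻ t in Ioo (0:ℝ) (μ univ).toReal, φ (rearrangement μ f t) =
      ∫⁻ x, φ (‖f x‖₊ : ℝ≥0∞) ∂μ := by
  rw [← lintegral_map hφ (rearr_antitone μ f).measurable, rearr_map μ f hf,
    lintegral_map hφ (by fun_prop)]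

lemma rearr_ae_ne_top {α : Type*} [MeasurableSpace α] (μ : Measure α) [IsFiniteMeasure μ]
    (f : α → ℂ) (hf : Measurable f) :
    ∀ᵐ t ∂(volume.restrict (Ioo (0:ℝ) (μ univ).toReal)), rearrangement μ f t ≠ ⊤ := by
  have hs : MeasurableSet {y : ℝ≥0∞ | y ≠ ⊤} := (measurableSet_singleton ⊤).compl
  rw [← ae_map_iff (p := fun y => y ≠ ⊤) (rearr_antitone μ f).measurable.aemeasurable hs,
    rearr_map μ f hf, ae_map_iff (by fun_prop) hs]
  simp

lemma phi_lintegral {α : Type*} [MeasurableSpace α] (μ : Measure α) [IsFiniteMeasure μ]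
    (f : α → ℂ) (hf : Measurable f) (r c : ℝ) :
    ∫⁻ t in Ioo (0:ℝ) (μ univ).toReal,
      ENNReal.ofReal (PhiR r ((rearrangement μ f t).toReal / c)) =
      ∫⁻ x, ENNReal.ofReal (PhiR r (‖f x‖ / c)) ∂μ := by
  have := rearr_lintegral μ f hf (fun y => ENNReal.ofReal (PhiR r (y.toReal / c)))
    (by unfold PhiR; fun_prop)
  simpa using this

/-- Restricting the Lorentz–Zygmund integral to `(0, μ(S))`. -/
lemma lz_eq {α : Type*} [MeasurableSpace α] (μ : Measure α) [IsFiniteMeasure μ]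
    (f : α → ℂ) (r : ℝ) :
    lorentzZygmundNorm μ r f = ∫⁻ t in Ioo (0:ℝ) (μ univ).toReal,
      rearrangement μ f t * ENNReal.ofReal ((1 + |Real.log t|) ^ r) := by
  unfold lorentzZygmundNorm
  symm
  rw [← lintegral_indicator measurableSet_Ioi, ← lintegral_indicator measurableSet_Ioo]
  refine lintegral_congr fun t => ?_
  by_cases h0 : t ∈ Ioi (0:ℝ)
  swap
  · rw [indicator_of_notMem h0, indicator_of_notMem (fun h => h0 h.1)]
  by_cases hlt : t < (μ univ).toReal
  · rw [indicator_of_mem h0, indicator_of_mem (show t ∈ Ioo _ _ from ⟨h0, hlt⟩)]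
  rw [indicator_of_mem h0, indicator_of_notMem (fun h => hlt h.2)]
  have h1 : (μ univ).toReal ≤ t := not_lt.1 hlt
  have : rearrangement μ f t ≤ 0 := by
    rw [rearr_le_iff]
    exact (measure_mono (subset_univ _)).trans
      ((ENNReal.le_ofReal_iff_toReal_le (measure_ne_top _ _) (le_of_lt h0)).2 h1)
  rw [le_zero_iff.1 this, zero_mul]

lemma rearr_le_div {α : Type*} [MeasurableSpace α] (μ : Measure α)
    (f : α → ℂ) (r : ℝ) (hr : 0 < r) (t : ℝ) :
    rearrangement μ f t * ENNReal.ofReal t ≤ lorentzZygmundNorm μ r f := by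
  unfold lorentzZygmundNorm
  calc rearrangement μ f t * ENNReal.ofReal t
      = ∫⁻ s in Ioo (0:ℝ) t, rearrangement μ f t := by simp
    _ ≤ ∫⁻ s in Ioo (0:ℝ) t, rearrangement μ f s * ENNReal.ofReal ((1 + |Real.log s|) ^ r) := by
        refine setLIntegral_mono' measurableSet_Ioo fun s hs => ?_
        refine le_trans (rearr_antitone μ f hs.2.le) (le_mul_of_one_le_right' ?_)
        rw [ENNReal.one_le_ofReal]
        exact Real.one_le_rpow (by linarith [abs_nonneg (Real.log s)]) hr.le
    _ ≤ _ := lintegral_mono_set (fun x hx => hx.1)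

lemma phi_le_of_le_inv (r x t : ℝ) (hr : 0 < r) (ht : 0 < t) (hx : 0 ≤ x) (hxt : x ≤ 1 / t) :
    PhiR r x ≤ x * (2 ^ r * (1 + |Real.log t|) ^ r) := by
  unfold PhiR
  refine mul_le_mul_of_nonneg_left ?_ hx
  rw [← Real.mul_rpow (by norm_num) (by positivity)]
  have h0 : 0 ≤ Real.log (1 + x) := Real.log_nonneg (by linarith)
  have hlog : Real.log (1 + x) ≤ 1 + |Real.log t| := by
    have e1 : Real.log (1 + x) ≤ Real.log (2 * Real.exp |Real.log t|) := by
      refine Real.log_le_log (by linarith) ?_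
      have h1 : 1 / t ≤ Real.exp |Real.log t| := by
        have : 1 / t = Real.exp (- Real.log t) := by
          rw [Real.exp_neg, Real.exp_log ht, one_div]
        rw [this]
        exact Real.exp_le_exp.2 (neg_le_abs _)
      have h2 : 1 ≤ Real.exp |Real.log t| := Real.one_le_exp (abs_nonneg _)
      linarith
    rw [Real.log_mul (by norm_num) (Real.exp_pos _).ne', Real.log_exp] at e1
    have := Real.log_two_lt_d9
    linarith
  have := Real.rpow_le_rpow (z := r) (by linarith : (0:ℝ) ≤ 1 + Real.log (1 + x))
    (by linarith [abs_nonneg (Real.log t)] :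
      1 + Real.log (1 + x) ≤ 2 * (1 + |Real.log t|)) hr.le
  linarith

lemma lux_le {α : Type*} [MeasurableSpace α] (μ : Measure α) [IsFiniteMeasure μ]
    (f : α → ℂ) (hf : Measurable f) (r : ℝ) (hr : 0 < r) (N : ℝ) (hN : 0 < N)
    (h : lorentzZygmundNorm μ r f ≤ ENNReal.ofReal N) :
    luxemburgNorm μ r f ≤ ENNReal.ofReal (2 ^ r * N) := by
  have hK : (1:ℝ) ≤ 2 ^ r := Real.one_le_rpow (by norm_num) hr.le
  refine sInf_le ⟨2 ^ r * N, by positivity, rfl, ?_⟩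
  rw [← phi_lintegral μ f hf]
  calc _ ≤ ∫⁻ t in Ioo (0:ℝ) (μ univ).toReal, ENNReal.ofReal (1 / N) *
        (rearrangement μ f t * ENNReal.ofReal ((1 + |Real.log t|) ^ r)) := by
        refine setLIntegral_mono' measurableSet_Ioo fun t ht => ?_
        have ht0 : 0 < t := ht.1
        have h1 := (rearr_le_div μ f r hr t).trans h
        have hfin : rearrangement μ f t ≠ ⊤ := by
          intro htop
          rw [htop, ENNReal.top_mul (by simpa using ht0)] at h1
          exact absurd h1 (by simp)
        set y := (rearrangement μ f t).toReal with hy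
        have hy0 : 0 ≤ y := ENNReal.toReal_nonneg
        rw [← ENNReal.ofReal_toReal hfin, ← hy, ← ENNReal.ofReal_mul hy0,
          ENNReal.ofReal_le_ofReal_iff hN.le] at h1
        rw [← ENNReal.ofReal_toReal hfin, ← hy, ← ENNReal.ofReal_mul hy0,
          ← ENNReal.ofReal_mul (by positivity)]
        refine ENNReal.ofReal_le_ofReal ?_
        refine (phi_le_of_le_inv r (y / (2 ^ r * N)) t hr ht0 (by positivity) ?_).trans ?_
        · rw [div_le_div_iff₀ (by positivity) ht0]
          nlinarith
        · apply le_of_eq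
          field_simp
    _ = ENNReal.ofReal (1 / N) * lorentzZygmundNorm μ r f := by
        rw [lz_eq, lintegral_const_mul' _ _ ENNReal.ofReal_ne_top]
    _ ≤ ENNReal.ofReal (1 / N) * ENNReal.ofReal N := by gcongr
    _ = 1 := by
        rw [← ENNReal.ofReal_mul (by positivity), one_div, inv_mul_cancel₀ hN.ne']
        simp

lemma x_le_phi (r x : ℝ) (hr : 0 < r) (hx : 0 ≤ x) :
    x * (1 + Real.log (1 + x)) ^ r ≤
      2 * (1 + Real.log 3) ^ r + 2 ^ r / (2 ^ r - 1) * PhiR r x := by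
  have h2 : (1:ℝ) < 2 ^ r := Real.one_lt_rpow (by norm_num) hr
  have h0 : 0 ≤ Real.log (1 + x) := Real.log_nonneg (by linarith)
  have h3 : 0 ≤ Real.log 3 := Real.log_nonneg (by norm_num)
  have hP1 : 1 ≤ (1 + Real.log (1 + x)) ^ r := Real.one_le_rpow (by linarith) hr.le
  have hd : 0 < (2:ℝ) ^ r - 1 := by linarith
  unfold PhiR
  rcases le_total x 2 with h | h
  · have a : x * (1 + Real.log (1 + x)) ^ r ≤ 2 * (1 + Real.log 3) ^ r := by
      gcongr
      linarith
    have b : 0 ≤ 2 ^ r / (2 ^ r - 1) * (x * ((1 + Real.log (1 + x)) ^ r - 1)) :=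
      mul_nonneg (by positivity) (mul_nonneg hx (by linarith))
    linarith
  · have hl : 1 ≤ Real.log (1 + x) := by
      rw [Real.le_log_iff_exp_le (by linarith)]
      linarith [Real.exp_one_lt_d9]
    have hP : (2:ℝ) ^ r ≤ (1 + Real.log (1 + x)) ^ r :=
      Real.rpow_le_rpow (by norm_num) (by linarith) hr.le
    set P := (1 + Real.log (1 + x)) ^ r
    have : P ≤ 2 ^ r / (2 ^ r - 1) * (P - 1) := by
      rw [div_mul_eq_mul_div, le_div_iff₀ hd]
      nlinarith
    have := mul_le_mul_of_nonneg_left this hx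
    have : 0 ≤ 2 * (1 + Real.log 3) ^ r := by positivity
    linarith

lemma main_pointwise (r m x t : ℝ) (hr : 0 < r) (hm : 1 ≤ m) (ht : 0 < t) (htm : t < m)
    (hx : 0 ≤ x) :
    x * (1 + |Real.log t|) ^ r ≤ (1 + Real.log m) ^ r *
      ((1 + 4 * r) ^ r * (t / m) ^ (-(3/4) : ℝ) + 2 ^ r * (2 * (1 + Real.log 3) ^ r +
        2 ^ r / (2 ^ r - 1) * PhiR r x)) := by
  have hm0 : 0 < m := by linarith
  obtain ⟨u, hu⟩ : ∃ u, u = t / m := ⟨_, rfl⟩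
  have hu0 : 0 < u := by rw [hu]; positivity
  have hu1 : u < 1 := by rw [hu, div_lt_one hm0]; exact htm
  have hlm : 0 ≤ Real.log m := Real.log_nonneg hm
  have hlu : Real.log u < 0 := Real.log_neg hu0 hu1
  have hlt : Real.log t = Real.log m + Real.log u := by
    rw [hu, Real.log_div ht.ne' hm0.ne']; ring
  have hw : (1 + |Real.log t|) ^ r ≤ (1 + Real.log m) ^ r * (1 - Real.log u) ^ r := by
    rw [← Real.mul_rpow (by linarith) (by linarith)]
    refine Real.rpow_le_rpow (by positivity) ?_ hr.le
    have : |Real.log t| ≤ Real.log m - Real.log u := by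
      rw [abs_le]; constructor <;> linarith
    nlinarith
  have hphi := x_le_phi r x hr hx
  have hlx : 0 ≤ Real.log (1 + x) := Real.log_nonneg (by linarith)
  have hpos1 : 0 ≤ x * (1 + Real.log (1 + x)) ^ r := by positivity
  have hL : 0 ≤ (1 + Real.log m) ^ r := by positivity
  have key : x * (1 - Real.log u) ^ r ≤ (1 + 4 * r) ^ r * u ^ (-(3/4) : ℝ) + 2 ^ r *
      (x * (1 + Real.log (1 + x)) ^ r) := by
    rcases le_or_gt x (u ^ (-(1/2) : ℝ)) with h | h
    · have a : (1 - Real.log u) ^ r ≤ (1 + 4 * r) ^ r * u ^ (-(1/4) : ℝ) := by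
        have b : 1 - Real.log u ≤ (1 + 4 * r) * u ^ (-(1/(4*r)) : ℝ) := by
          have c := Real.log_le_rpow_div (x := u⁻¹) (ε := 1/(4*r)) (by positivity) (by positivity)
          rw [Real.log_inv, Real.inv_rpow hu0.le, ← Real.rpow_neg hu0.le, div_div_eq_mul_div,
            div_one] at c
          have d : 1 ≤ u ^ (-(1/(4*r)) : ℝ) :=
            Real.one_le_rpow_of_pos_of_le_one_of_nonpos hu0 hu1.le
              (by rw [neg_nonpos]; positivity)
          linarith
        have e := Real.rpow_le_rpow (by linarith) b hr.le
        rw [Real.mul_rpow (by positivity) (by positivity), ← Real.rpow_mul hu0.le] at e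
        have : -(1 / (4 * r)) * r = (-(1/4) : ℝ) := by field_simp
        rwa [this] at e
      have b : x * (1 - Real.log u) ^ r ≤ u ^ (-(1/2) : ℝ) * ((1 + 4 * r) ^ r * u ^ (-(1/4) : ℝ)) :=
        mul_le_mul h a (Real.rpow_nonneg (by linarith) _) (by positivity)
      have c : u ^ (-(3/4) : ℝ) = u ^ (-(1/2) : ℝ) * u ^ (-(1/4) : ℝ) := by
        rw [← Real.rpow_add hu0]; norm_num
      have : 0 ≤ 2 ^ r * (x * (1 + Real.log (1 + x)) ^ r) := by positivity
      rw [c]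
      linarith
    · have hx0 : 0 < x := lt_of_le_of_lt (by positivity) h
      have a : - Real.log u ≤ 2 * Real.log x := by
        have := Real.log_le_log (by positivity) h.le
        rw [Real.log_rpow hu0] at this
        linarith
      have b : Real.log x ≤ Real.log (1 + x) := Real.log_le_log hx0 (by linarith)
      have c : (1 - Real.log u) ^ r ≤ 2 ^ r * (1 + Real.log (1 + x)) ^ r := by
        rw [← Real.mul_rpow (by norm_num) (by linarith)]
        exact Real.rpow_le_rpow (by linarith) (by linarith) hr.le
      have d := mul_le_mul_of_nonneg_left c hx
      have : 0 ≤ (1 + 4 * r) ^ r * u ^ (-(3/4) : ℝ) := by positivity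
      linarith
  rw [← hu]
  calc x * (1 + |Real.log t|) ^ r ≤ x * ((1 + Real.log m) ^ r * (1 - Real.log u) ^ r) := by gcongr
    _ = (1 + Real.log m) ^ r * (x * (1 - Real.log u) ^ r) := by ring
    _ ≤ _ := by
      refine mul_le_mul_of_nonneg_left (key.trans ?_) hL
      gcongr

lemma integrand_fin (r m M : ℝ) (hm : 1 ≤ m) :
    ∫⁻ t in Ioo (0:ℝ) M, ENNReal.ofReal ((1 + Real.log m) ^ r *
      ((1 + 4 * r) ^ r * (t / m) ^ (-(3/4) : ℝ) + 2 ^ r * (2 * (1 + Real.log 3) ^ r))) < ⊤ := by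
  have hm0 : 0 < m := by linarith
  have h1 : IntegrableOn (fun t : ℝ => t ^ (-(3/4) : ℝ)) (Ioo 0 M) := by
    rcases le_or_gt M 0 with h | h
    · rw [Ioo_eq_empty (by linarith)]; simp
    · exact (intervalIntegral.integrableOn_Ioo_rpow_iff h).2 (by norm_num)
  have h2 : IntegrableOn (fun t : ℝ => (t / m) ^ (-(3/4) : ℝ)) (Ioo 0 M) := by
    refine IntegrableOn.congr_fun (h1.div_const (m ^ (-(3/4) : ℝ))) ?_ measurableSet_Ioo
    intro t ht
    exact (Real.div_rpow ht.1.le hm0.le _).symm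
  have h3 : IntegrableOn (fun t : ℝ => (1 + Real.log m) ^ r *
      ((1 + 4 * r) ^ r * (t / m) ^ (-(3/4) : ℝ) + 2 ^ r * (2 * (1 + Real.log 3) ^ r)))
      (Ioo 0 M) :=
    ((h2.const_mul _).add (integrableOn_const (by simp))).const_mul _
  exact h3.lintegral_lt_top

/-- (Bennett–Rudnick) On a finite measure space, the Orlicz space for
`Φ_r(t) = t([1 + log(1+t)]^r - 1)` coincides with the Lorentz–Zygmund space
`L log^r L`, with equivalent norms. -/
theorem orlicz_eq_lorentzZygmund {α : Type*} [MeasurableSpace α] (μ : Measure α)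
    [IsFiniteMeasure μ] (r : ℝ) (hr : 0 < r) :
    ∃ c C : ℝ, 0 < c ∧ 0 < C ∧ ∀ f : α → ℂ, Measurable f →
      ENNReal.ofReal c * luxemburgNorm μ r f ≤ lorentzZygmundNorm μ r f ∧
      lorentzZygmundNorm μ r f ≤ ENNReal.ofReal C * luxemburgNorm μ r f := by
  set M := (μ univ).toReal with hM
  set m := max M 1 with hm
  have hm1 : 1 ≤ m := le_max_right _ _
  have hMm : M ≤ m := le_max_left _ _
  have h2 : (1:ℝ) < 2 ^ r := Real.one_lt_rpow (by norm_num) hr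
  have hlm : 0 ≤ Real.log m := Real.log_nonneg hm1
  set J := ∫⁻ t in Ioo (0:ℝ) M, ENNReal.ofReal ((1 + Real.log m) ^ r *
      ((1 + 4 * r) ^ r * (t / m) ^ (-(3/4) : ℝ) + 2 ^ r * (2 * (1 + Real.log 3) ^ r))) with hJ
  have hJt : J ≠ ⊤ := (integrand_fin r m M hm1).ne
  set B := (1 + Real.log m) ^ r * (2 ^ r * (2 ^ r / (2 ^ r - 1))) with hB
  have hB0 : 0 < B := by
    have : 0 < (2:ℝ) ^ r - 1 := by linarith
    positivity
  refine ⟨(2 ^ r)⁻¹, J.toReal + B, by positivity, by positivity, fun f hf => ⟨?_, ?_⟩⟩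
  · refine le_of_forall_gt_imp_ge_of_dense fun b hb => ?_
    by_cases hbt : b = ⊤
    · rw [hbt]; exact le_top
    have hb0 : 0 < b.toReal := ENNReal.toReal_pos (ne_bot_of_gt hb) hbt
    have := lux_le μ f hf r hr b.toReal hb0 (by rw [ENNReal.ofReal_toReal hbt]; exact hb.le)
    calc _ ≤ ENNReal.ofReal ((2 ^ r)⁻¹) * ENNReal.ofReal (2 ^ r * b.toReal) := by gcongr
      _ = b := by
        rw [← ENNReal.ofReal_mul (by positivity), inv_mul_cancel_left₀ (by positivity),
          ENNReal.ofReal_toReal hbt]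
  · unfold luxemburgNorm
    have hC0 : ENNReal.ofReal (J.toReal + B) ≠ 0 := by
      rw [← pos_iff_ne_zero, ENNReal.ofReal_pos]; positivity
    rw [← ENNReal.div_le_iff' hC0 ENNReal.ofReal_ne_top]
    refine le_sInf fun l hl => ?_
    rw [ENNReal.div_le_iff' hC0 ENNReal.ofReal_ne_top]
    obtain ⟨c, hc, rfl, hI⟩ := hl
    rw [← phi_lintegral μ f hf, ← hM] at hI
    rw [lz_eq, ← hM]
    have hpt : ∀ᵐ t ∂(volume.restrict (Ioo (0:ℝ) M)),
        rearrangement μ f t * ENNReal.ofReal ((1 + |Real.log t|) ^ r) ≤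
        ENNReal.ofReal c * (ENNReal.ofReal ((1 + Real.log m) ^ r *
      ((1 + 4 * r) ^ r * (t / m) ^ (-(3/4) : ℝ) + 2 ^ r * (2 * (1 + Real.log 3) ^ r))) +
        ENNReal.ofReal B * ENNReal.ofReal (PhiR r ((rearrangement μ f t).toReal / c))) := by
      filter_upwards [rearr_ae_ne_top μ f hf, ae_restrict_mem measurableSet_Ioo] with t ht htm
      set y := (rearrangement μ f t).toReal with hy
      have hy0 : 0 ≤ y := ENNReal.toReal_nonneg
      have h := main_pointwise r m (y / c) t hr hm1 htm.1 (htm.2.trans_le hMm) (by positivity)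
      rw [← ENNReal.ofReal_toReal ht, ← hy, ← ENNReal.ofReal_mul hy0, ← ENNReal.ofReal_mul hB0.le]
      refine le_trans ?_ (mul_le_mul_right ENNReal.ofReal_add_le _)
      rw [← ENNReal.ofReal_mul hc.le]
      refine ENNReal.ofReal_le_ofReal ?_
      calc y * (1 + |Real.log t|) ^ r = c * (y / c * (1 + |Real.log t|) ^ r) := by field_simp
        _ ≤ _ := mul_le_mul_of_nonneg_left h hc.le
        _ = _ := by rw [hB]; ring
    calc _ ≤ _ := lintegral_mono_ae hpt
      _ = ENNReal.ofReal c * (J + ENNReal.ofReal B * ∫⁻ t in Ioo (0:ℝ) M,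
          ENNReal.ofReal (PhiR r ((rearrangement μ f t).toReal / c))) := by
        rw [lintegral_const_mul' _ _ ENNReal.ofReal_ne_top, lintegral_add_left (by fun_prop),
          lintegral_const_mul' _ _ ENNReal.ofReal_ne_top]
      _ ≤ ENNReal.ofReal c * (J + ENNReal.ofReal B * 1) := by gcongr
      _ = _ := by
        rw [ENNReal.ofReal_add ENNReal.toReal_nonneg hB0.le, ENNReal.ofReal_toReal hJt, mul_one,
          mul_comm]
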